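/- Let V be a finite free Z̄_ℓ-module and T : V → V a Z̄_ℓ-linear endomorphism. Let W ⊆ V be a T-stable submodule such that W and V/W are both finite free Z̄_ℓ-modules. Let α, β ∈ Z̄_ℓ with α ≠ β, and suppose that T w = α w for all w ∈ W and that the endomorphism of V/W induced by T is β·id (i.e., T v − β v ∈ W for all v ∈ V). Let v ∈ V ⊗_{Z̄_ℓ} Q̄_ℓ be such that (T ⊗ id)(v) = β v and v lies in V' + W'_ℚ, where V' denotes the image of V in V ⊗_{Z̄_ℓ} Q̄_ℓ and W'_ℚ denotes the Q̄_ℓ-span of the image of W. Then (α − β)·v ∈ V'. -/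

import Mathlib

set_option synthInstance.maxHeartbeats 1000000
set_option maxHeartbeats 2000000
open TensorProduct

/-- If `T` acts on `W` as multiplication by `a`, then so does its base change on the span of the
image of `W`. -/
theorem baseChange_eq_smul_of_mem_span {R A V : Type*} [CommRing R] [CommRing A] [Algebra R A]
    [AddCommGroup V] [Module R V] (T : V →ₗ[R] V) (W : Submodule R V) (a : R)
    (hTW : ∀ w ∈ W, T w = a • w) {u : A ⊗[R] V}
    (hu : u ∈ Submodule.span A (TensorProduct.mk R A V 1 '' (W : Set V))) :
    LinearMap.baseChange A T u = a • u := by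
  induction hu using Submodule.span_induction with
  | mem x hx =>
    obtain ⟨w, hw, rfl⟩ := hx
    simp [hTW w hw]
  | zero => simp
  | add x y _ _ hx hy => rw [map_add, hx, hy, smul_add]
  | smul c x _ hx => rw [map_smul, hx, smul_comm]

/-- An eigenvector of eigenvalue `b` in `V' + W'`, where `T` acts on `W` as multiplication by `a`,
lies in the image of `V` after multiplication by `a - b`. -/
theorem sub_smul_mem_range_mk_of_baseChange_eq_smul {R A V : Type*} [CommRing R] [CommRing A]
    [Algebra R A] [AddCommGroup V] [Module R V] (T : V →ₗ[R] V) (W : Submodule R V) (a b : R)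
    (hTW : ∀ w ∈ W, T w = a • w) (v : A ⊗[R] V)
    (hv : LinearMap.baseChange A T v = b • v)
    (hv' : v ∈ LinearMap.range (TensorProduct.mk R A V 1) ⊔
      Submodule.restrictScalars R
        (Submodule.span A (TensorProduct.mk R A V 1 '' (W : Set V)))) :
    (a - b) • v ∈ LinearMap.range (TensorProduct.mk R A V 1) := by
  obtain ⟨_, ⟨x, rfl⟩, u, hu, rfl⟩ := Submodule.mem_sup.mp hv'
  have hTu := baseChange_eq_smul_of_mem_span T W a hTW hu
  refine ⟨a • x - T x, ?_⟩
  rw [map_add, hTu] at hv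
  simp only [TensorProduct.mk_apply, LinearMap.baseChange_tmul] at hv
  have hsub : (a - b) • ((1 : A) ⊗ₜ[R] x + u) + b • ((1 : A) ⊗ₜ[R] x + u) =
      a • ((1 : A) ⊗ₜ[R] x + u) := by
    rw [← add_smul, sub_add_cancel]
  rw [TensorProduct.mk_apply, TensorProduct.mk_apply, eq_sub_of_add_eq hsub, ← hv,
    TensorProduct.tmul_sub, TensorProduct.tmul_smul, smul_add]
  abel

/-- **Lemma `denominators-lemma`**.  Let `Z̄_ℓ` be the valuation ring of `Q̄_ℓ`
(the integral closure of `ℤ_ℓ` in an algebraic closure `K` of `ℚ_ℓ`).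
Let `V` be a finite free `Z̄_ℓ`-module and `T : V → V` an endomorphism.  Let `W ⊆ V` be a
`T`-stable submodule with `W` and `V/W` finite free.  Suppose `T` acts on `W` as `α·id`
and on `V/W` as `β·id`, with `α ≠ β`.  If `v ∈ V ⊗ Q̄_ℓ` satisfies `T v = β v` and
`v ∈ V' + W'_ℚ` (where `V'` is the image of `V` and `W'_ℚ` the `Q̄_ℓ`-span of the image
of `W`), then `(α − β)·v ∈ V'`. -/
theorem smul_mem_of_eigenvector
    (ℓ : ℕ) [Fact ℓ.Prime]
    [Algebra ℤ_[ℓ] (AlgebraicClosure ℚ_[ℓ])]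
    [IsScalarTower ℤ_[ℓ] ℚ_[ℓ] (AlgebraicClosure ℚ_[ℓ])]
    (V : Type*) [AddCommGroup V]
    [Module (integralClosure ℤ_[ℓ] (AlgebraicClosure ℚ_[ℓ])) V]
    [Module.Finite (integralClosure ℤ_[ℓ] (AlgebraicClosure ℚ_[ℓ])) V]
    [Module.Free (integralClosure ℤ_[ℓ] (AlgebraicClosure ℚ_[ℓ])) V]
    (T : V →ₗ[integralClosure ℤ_[ℓ] (AlgebraicClosure ℚ_[ℓ])] V)
    (W : Submodule (integralClosure ℤ_[ℓ] (AlgebraicClosure ℚ_[ℓ])) V)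
    (hWstable : ∀ w ∈ W, T w ∈ W)
    [Module.Finite (integralClosure ℤ_[ℓ] (AlgebraicClosure ℚ_[ℓ])) W]
    [Module.Free (integralClosure ℤ_[ℓ] (AlgebraicClosure ℚ_[ℓ])) W]
    [Module.Finite (integralClosure ℤ_[ℓ] (AlgebraicClosure ℚ_[ℓ])) (V ⧸ W)]
    [Module.Free (integralClosure ℤ_[ℓ] (AlgebraicClosure ℚ_[ℓ])) (V ⧸ W)]
    (α β : integralClosure ℤ_[ℓ] (AlgebraicClosure ℚ_[ℓ]))
    (hαβ : α ≠ β)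
    (hTW : ∀ w ∈ W, T w = α • w)
    (hTV : ∀ x : V, T x - β • x ∈ W)
    (v : (AlgebraicClosure ℚ_[ℓ]) ⊗[integralClosure ℤ_[ℓ] (AlgebraicClosure ℚ_[ℓ])] V)
    (hv1 : LinearMap.baseChange (AlgebraicClosure ℚ_[ℓ]) T v
      = algebraMap (integralClosure ℤ_[ℓ] (AlgebraicClosure ℚ_[ℓ])) (AlgebraicClosure ℚ_[ℓ]) β • v)
    (hv2 : v ∈
      LinearMap.range (TensorProduct.mk (integralClosure ℤ_[ℓ] (AlgebraicClosure ℚ_[ℓ]))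
          (AlgebraicClosure ℚ_[ℓ]) V 1) ⊔
        Submodule.restrictScalars (integralClosure ℤ_[ℓ] (AlgebraicClosure ℚ_[ℓ]))
          (Submodule.span (AlgebraicClosure ℚ_[ℓ])
            ((TensorProduct.mk (integralClosure ℤ_[ℓ] (AlgebraicClosure ℚ_[ℓ]))
              (AlgebraicClosure ℚ_[ℓ]) V 1) '' (W : Set V)))) :
    (α - β) • v ∈
      LinearMap.range (TensorProduct.mk (integralClosure ℤ_[ℓ] (AlgebraicClosure ℚ_[ℓ]))
        (AlgebraicClosure ℚ_[ℓ]) V 1) := by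
  exact sub_smul_mem_range_mk_of_baseChange_eq_smul T W α β hTW v
    (hv1.trans (algebraMap_smul _ β v)) hv2
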